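/- For the finite-dimensional Lie algebra m_0(n), dim H^2(m_0(n)) = ⌊(n+1)/2⌋. -/

import Mathlib

variable (K : Type*) [Field K] [CharZero K]

/-- The cochain `e^i` (`i ≥ 1`) dual to the basis vector `e_i` of the filiform Lie
algebra `m₀(n)` (basis `e_1, ..., e_n`, brackets `[e_1, e_i] = e_{i+1}`,
`2 ≤ i ≤ n-1`). -/
noncomputable def e (i : ℕ) : ExteriorAlgebra K (ℕ →₀ K) :=
  ExteriorAlgebra.ι K (Finsupp.single (i - 1) (1 : K))

/-- The monomial cochain `e^{i_1} ∧ ... ∧ e^{i_q}`. -/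
noncomputable def mono (s : Finset ℕ) : ExteriorAlgebra K (ℕ →₀ K) :=
  ((s.sort (· ≤ ·)).map (e K)).prod

/-- `C^q(m₀(n))`: the span of the `q`-cochains `e^{i_1} ∧ ... ∧ e^{i_q}` with
`1 ≤ i_1 < ... < i_q ≤ n`. -/
noncomputable def C (n q : ℕ) : Submodule K (ExteriorAlgebra K (ℕ →₀ K)) :=
  Submodule.span K {x | ∃ s : Finset ℕ,
    s.card = q ∧ (∀ i ∈ s, 1 ≤ i ∧ i ≤ n) ∧ x = mono K s}

set_option linter.unusedSectionVars false

/-- Contraction with the basis vector `e_i`. -/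
noncomputable def contr (i : ℕ) : ExteriorAlgebra K (ℕ →₀ K) →ₗ[K] ExteriorAlgebra K (ℕ →₀ K) :=
  CliffordAlgebra.contractLeft (Q := 0) (Finsupp.lapply (i - 1))

lemma contr_e_mul {i a : ℕ} (hi : 1 ≤ i) (ha : 1 ≤ a) (x : ExteriorAlgebra K (ℕ →₀ K)) :
    contr K i (e K a * x) = (if i = a then x else 0) - e K a * contr K i x := by
  have h : (a - 1 = i - 1) = (i = a) := by rw [eq_iff_iff]; omega
  refine (CliffordAlgebra.contractLeft_ι_mul (Q := 0) ..).trans ?_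
  simp [Finsupp.single_apply, h, ite_smul]
  rfl

lemma mono_pair {a b : ℕ} (h : a < b) : mono K {a, b} = e K a * e K b := by
  rw [mono, Finset.sort_insert] <;> simp [h.ne, h.le]

lemma mono_singleton (a : ℕ) : mono K {a} = e K a := by simp [mono]

lemma C_one (n : ℕ) : C K n 1 = Submodule.span K {x | ∃ a, 1 ≤ a ∧ a ≤ n ∧ x = e K a} := by
  rw [C]; congr 1; ext x; constructor
  · rintro ⟨s, hs, h, rfl⟩
    obtain ⟨a, rfl⟩ := Finset.card_eq_one.1 hs
    exact ⟨a, (h a (by simp)).1, (h a (by simp)).2, mono_singleton K a⟩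
  · rintro ⟨a, h, h', rfl⟩
    exact ⟨{a}, by simp, by simp [h, h'], (mono_singleton K a).symm⟩

lemma C_two (n : ℕ) : C K n 2 =
    Submodule.span K {x | ∃ a b, 1 ≤ a ∧ a < b ∧ b ≤ n ∧ x = e K a * e K b} := by
  rw [C]; congr 1; ext x; constructor
  · rintro ⟨s, hs, h, rfl⟩
    obtain ⟨a, b, hab, rfl⟩ := Finset.card_eq_two.1 hs
    have ha := h a (by simp)
    have hb := h b (by simp)
    rcases hab.lt_or_gt with hab | hab
    · exact ⟨a, b, ha.1, hab, hb.2, mono_pair K hab⟩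
    · exact ⟨b, a, hb.1, hab, ha.2, by rw [Finset.pair_comm, mono_pair K hab]⟩
  · rintro ⟨a, b, h, hab, h', rfl⟩
    refine ⟨{a, b}, Finset.card_pair hab.ne, ?_, (mono_pair K hab).symm⟩
    simp; omega

lemma contr_e {i a : ℕ} (hi : 1 ≤ i) (ha : 1 ≤ a) :
    contr K i (e K a) = if i = a then 1 else 0 := by
  have h := contr_e_mul K hi ha 1
  simpa [contr, CliffordAlgebra.contractLeft_one (Q := (0 : QuadraticForm K (ℕ →₀ K)))] using h

/-- The coefficient of a 2-cochain at `e^i ∧ e^j`. -/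
noncomputable def coord (i j : ℕ) : ExteriorAlgebra K (ℕ →₀ K) →ₗ[K] K :=
  ExteriorAlgebra.algebraMapInv.toLinearMap ∘ₗ contr K j ∘ₗ contr K i

lemma coord_e_mul_e {i j a b : ℕ} (hi : 1 ≤ i) (hj : 1 ≤ j) (ha : 1 ≤ a) (hb : 1 ≤ b) :
    coord K i j (e K a * e K b) =
      (if i = a ∧ j = b then 1 else 0) - (if i = b ∧ j = a then 1 else 0) := by
  have h : contr K j (e K a * if i = b then 1 else 0) = if i = b ∧ j = a then 1 else 0 := by
    split_ifs <;> simp_all [contr_e]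
  have h' : contr K j (if i = a then e K b else 0) = if i = a ∧ j = b then 1 else 0 := by
    split_ifs <;> simp_all [contr_e]
  simp only [coord, LinearMap.comp_apply, contr_e_mul K hi ha, contr_e K hi hb, map_sub, h, h']
  split_ifs <;> simp

lemma contr_one_e_one_mul {a b : ℕ} (ha : 2 ≤ a) (hb : 2 ≤ b) :
    contr K 1 (e K 1 * (e K a * e K b)) = e K a * e K b := by
  rw [contr_e_mul K le_rfl le_rfl, contr_e_mul K le_rfl (by omega), contr_e K le_rfl (by omega),
    if_pos rfl, if_neg (by omega), if_neg (by omega)]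
  simp

lemma e_mul_self (a : ℕ) : e K a * e K a = 0 := ExteriorAlgebra.ι_sq_zero _

lemma e_mul_e_comm (a b : ℕ) : e K a * e K b = - (e K b * e K a) :=
  eq_neg_of_add_eq_zero_left (ExteriorAlgebra.ι_add_mul_swap _ _)

lemma e_mem_C_one {n a : ℕ} (ha : 1 ≤ a) (h : a ≤ n) : e K a ∈ C K n 1 := by
  rw [C_one]; exact Submodule.subset_span ⟨a, ha, h, rfl⟩

lemma e_mul_e_mem_C_two {n a b : ℕ} (ha : 1 ≤ a) (hab : a < b) (h : b ≤ n) :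
    e K a * e K b ∈ C K n 2 := by
  rw [C_two]; exact Submodule.subset_span ⟨a, b, ha, hab, h, rfl⟩

lemma coord_swap {n : ℕ} {x} (hx : x ∈ C K n 2) {i j : ℕ} (hi : 1 ≤ i) (hj : 1 ≤ j) :
    coord K i j x = - coord K j i x := by
  rw [C_two] at hx
  induction hx using Submodule.span_induction with
  | mem x h =>
    obtain ⟨a, b, ha, hab, hb, rfl⟩ := h
    rw [coord_e_mul_e K hi hj ha (by omega), coord_e_mul_e K hj hi ha (by omega)]
    simp [and_comm]
  | zero => simp
  | add x y _ _ hx hy => simp only [map_add, hx, hy, neg_add]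
  | smul c x _ hx => simp only [map_smul, hx, smul_neg]

lemma coord_self {n : ℕ} {x} (hx : x ∈ C K n 2) {i : ℕ} (hi : 1 ≤ i) :
    coord K i i x = 0 := by
  rw [C_two] at hx
  induction hx using Submodule.span_induction with
  | mem x h =>
    obtain ⟨a, b, ha, hab, hb, rfl⟩ := h
    rw [coord_e_mul_e K hi hi ha (by omega)]
    simp [and_comm]
  | zero => simp
  | add x y _ _ hx hy => simp only [map_add, hx, hy, add_zero]
  | smul c x _ hx => simp only [map_smul, hx, smul_zero]

lemma coord_eq_zero {n : ℕ} {x} (hx : x ∈ C K n 2) {i j : ℕ} (hi : 1 ≤ i) (hj : n < j) :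
    coord K i j x = 0 := by
  rw [C_two] at hx
  induction hx using Submodule.span_induction with
  | mem x h =>
    obtain ⟨a, b, ha, hab, hb, rfl⟩ := h
    rw [coord_e_mul_e K hi (by omega) ha (by omega), if_neg (by omega), if_neg (by omega), sub_zero]
  | zero => simp
  | add x y _ _ hx hy => simp only [map_add, hx, hy, add_zero]
  | smul c x _ hx => simp only [map_smul, hx, smul_zero]

lemma eq_sum_coord {n : ℕ} {x} (hx : x ∈ C K n 2) :
    x = ∑ i ∈ Finset.Icc 1 n, ∑ j ∈ Finset.Ioc i n, coord K i j x • (e K i * e K j) := by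
  rw [C_two] at hx
  induction hx using Submodule.span_induction with
  | mem x h =>
    obtain ⟨a, b, ha, hab, hb, rfl⟩ := h
    rw [Finset.sum_eq_single a, Finset.sum_eq_single b]
    · rw [coord_e_mul_e K ha (by omega) ha (by omega), if_pos (by simp), if_neg (by omega)]
      simp
    · intro j hj hjb
      rw [Finset.mem_Ioc] at hj
      rw [coord_e_mul_e K ha (by omega) ha (by omega), if_neg (by omega), if_neg (by omega)]
      simp
    · intro h
      simp at h; omega
    · intro i hi hia
      refine Finset.sum_eq_zero fun j hj => ?_
      rw [Finset.mem_Icc] at hi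
      rw [Finset.mem_Ioc] at hj
      rw [coord_e_mul_e K hi.1 (by omega) ha (by omega), if_neg (by omega), if_neg (by omega)]
      simp
    · intro h
      simp at h; omega
  | zero => simp
  | add x y _ _ hx hy =>
    nth_rw 1 [hx, hy]
    simp only [map_add, add_smul, Finset.sum_add_distrib]
  | smul c x _ hx =>
    nth_rw 1 [hx]
    simp only [map_smul, smul_assoc, Finset.smul_sum]

lemma eq_zero_of_recurrence {n : ℕ} {c : ℕ → ℕ → K}
    (swap : ∀ i j, 2 ≤ i → 2 ≤ j → c i j = - c j i)
    (self : ∀ i, 2 ≤ i → c i i = 0) (zero : ∀ i j, 2 ≤ i → n < j → c i j = 0)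
    (rec : ∀ i j, 2 ≤ i → 2 ≤ j → c (i + 1) j + c i (j + 1) = 0)
    (mid : ∀ k, 2 ≤ k → 2 * k ≤ n + 1 → c k (k + 1) = 0) (i j : ℕ) (hi : 2 ≤ i) (hj : 2 ≤ j) :
    c i j = 0 := by
  have shift : ∀ t i j, 2 ≤ i → 2 ≤ j → (c (i + t) j = 0 ↔ c i (j + t) = 0) := by
    intro t
    induction t with
    | zero => simp
    | succ t ih =>
      intro i j hi hj
      rw [show i + (t + 1) = (i + t) + 1 by ring, show j + (t + 1) = (j + 1) + t by ring,
        ← ih i (j + 1) hi (by omega), eq_neg_of_add_eq_zero_left (rec (i + t) j (by omega) hj),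
        neg_eq_zero]
  have mid' : ∀ k, 2 ≤ k → c k (k + 1) = 0 := by
    intro k hk
    by_cases h : 2 * k ≤ n + 1
    · exact mid k hk h
    · obtain ⟨t, rfl⟩ := Nat.exists_eq_add_of_le hk
      rw [shift t 2 _ le_rfl (by omega)]
      exact zero _ _ le_rfl (by omega)
  have main : ∀ i m, 2 ≤ i → c i (i + m) = 0 := by
    intro i m hi
    obtain ⟨t, rfl | rfl⟩ := Nat.even_or_odd' m
    · rw [two_mul, ← add_assoc, ← shift t i (i + t) hi (by omega)]
      exact self _ (by omega)
    · rw [show i + (2 * t + 1) = (i + t + 1) + t by ring, ← shift t i _ hi (by omega)]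
      exact mid' _ (by omega)
  rcases le_total i j with h | h <;> obtain ⟨m, rfl⟩ := Nat.exists_eq_add_of_le h
  · exact main i m hi
  · rw [swap _ _ hi hj, main j m hj, neg_zero]

/-- The conditions determining the Chevalley–Eilenberg differential of `m₀(n)` on the cochains of
degree at most two. -/
structure IsDifferential (n : ℕ) (d : Module.End K (ExteriorAlgebra K (ℕ →₀ K))) : Prop where
  leibniz : ∀ p : ℕ, ∀ x ∈ C K n p, ∀ y, d (x * y) = d x * y + ((-1 : K) ^ p) • (x * d y)
  one : d (e K 1) = 0
  two : d (e K 2) = 0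
  succ : ∀ i, 2 ≤ i → i ≤ n - 1 → d (e K (i + 1)) = e K 1 * e K i

namespace IsDifferential

variable {K} {n : ℕ} {d : Module.End K (ExteriorAlgebra K (ℕ →₀ K))}

lemma apply_e_mul (hd : IsDifferential K n d) {a : ℕ} (ha : 1 ≤ a) (h : a ≤ n) (y) :
    d (e K a * y) = d (e K a) * y - e K a * d y := by
  rw [hd.leibniz 1 _ (e_mem_C_one K ha h)]
  simp [sub_eq_add_neg]

lemma apply_e_one_mul_e (hd : IsDifferential K n d) {a : ℕ} (ha : 2 ≤ a) (h : a ≤ n) :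
    d (e K 1 * e K a) = 0 := by
  rw [hd.apply_e_mul le_rfl (by omega), hd.one, zero_mul, zero_sub, neg_eq_zero]
  obtain rfl | h' := ha.eq_or_lt
  · rw [hd.two, mul_zero]
  · obtain ⟨b, rfl⟩ := Nat.exists_eq_add_of_le' (show 1 ≤ a by omega)
    rw [hd.succ b (by omega) (by omega), ← mul_assoc, e_mul_self, zero_mul]

lemma apply_e_two_mul_e (hd : IsDifferential K n d) {b : ℕ} (hb : 2 ≤ b) (h : b + 1 ≤ n) :
    d (e K 2 * e K (b + 1)) = e K 1 * (e K 2 * e K b) := by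
  rw [hd.apply_e_mul (by omega) (by omega), hd.two, hd.succ b hb (by omega), zero_mul, zero_sub,
    ← mul_assoc, e_mul_e_comm K 2 1, neg_mul, neg_neg, mul_assoc]

lemma apply_e_mul_e (hd : IsDifferential K n d) {a b : ℕ} (ha : 2 ≤ a) (hb : 2 ≤ b)
    (h : a + 1 ≤ n) (h' : b + 1 ≤ n) :
    d (e K (a + 1) * e K (b + 1)) =
      e K 1 * (e K a * e K (b + 1)) + e K 1 * (e K (a + 1) * e K b) := by
  rw [hd.apply_e_mul (by omega) (by omega), hd.succ a ha (by omega), hd.succ b hb (by omega),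
    ← mul_assoc (e K (a + 1)), e_mul_e_comm K (a + 1) 1, neg_mul, sub_neg_eq_add, mul_assoc,
    mul_assoc]

lemma coord_contr_apply (hd : IsDifferential K n d) {x} (hx : x ∈ C K n 2) {i j : ℕ}
    (hi : 2 ≤ i) (hj : 2 ≤ j) :
    coord K i j (contr K 1 (d x)) = coord K (i + 1) j x + coord K i (j + 1) x := by
  rw [C_two] at hx
  induction hx using Submodule.span_induction with
  | mem x h =>
    obtain ⟨a, b, ha, hab, hb, rfl⟩ := h
    rw [coord_e_mul_e K (by omega) (by omega) ha (by omega),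
      coord_e_mul_e K (by omega) (by omega) ha (by omega)]
    obtain ⟨b, rfl⟩ := Nat.exists_eq_add_of_le' (show 1 ≤ b by omega)
    obtain rfl | rfl | ha : a = 1 ∨ a = 2 ∨ 3 ≤ a := by omega
    · rw [hd.apply_e_one_mul_e (by omega) hb, if_neg (by omega), if_neg (by omega),
        if_neg (by omega), if_neg (by omega)]
      simp
    · rw [hd.apply_e_two_mul_e (by omega) hb, contr_one_e_one_mul K le_rfl (by omega),
        coord_e_mul_e K (by omega) (by omega) (by omega) (by omega),
        if_neg (by omega : ¬ (i + 1 = 2 ∧ _)), if_neg (by omega : ¬ (i = b + 1 ∧ j + 1 = 2))]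
      simp only [Nat.add_right_cancel_iff]
      rw [zero_sub, sub_zero]
      ring
    · obtain ⟨a, rfl⟩ := Nat.exists_eq_add_of_le' (show 1 ≤ a by omega)
      rw [hd.apply_e_mul_e (by omega) (by omega) (by omega) hb, map_add, map_add,
        contr_one_e_one_mul K (by omega) (by omega), contr_one_e_one_mul K (by omega) (by omega),
        coord_e_mul_e K (by omega) (by omega) (by omega) (by omega),
        coord_e_mul_e K (by omega) (by omega) (by omega) (by omega)]
      simp only [Nat.add_right_cancel_iff]
      ring
  | zero => simp
  | add x y _ _ hx hy => simp only [map_add, hx, hy]; ring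
  | smul c x _ hx => simp only [map_smul, hx, smul_add]

end IsDifferential

/-- The cochain `∑ (-1)^i e^i ∧ e^{2k+1-i}`, the sum running over `2 ≤ i ≤ m + 2`. It is a cocycle
for `m + 2 = k`. -/
noncomputable def alternatingSum (k m : ℕ) : ExteriorAlgebra K (ℕ →₀ K) :=
  ∑ i ∈ Finset.range (m + 1), (-1 : K) ^ i • (e K (i + 2) * e K (2 * k - 1 - i))

lemma alternatingSum_mem {n k m : ℕ} (hm : m + 2 ≤ k) (h : 2 * k ≤ n + 1) :
    alternatingSum K k m ∈ C K n 2 := by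
  refine Submodule.sum_mem _ fun i hi => Submodule.smul_mem _ _ ?_
  rw [Finset.mem_range] at hi
  exact e_mul_e_mem_C_two K (by omega) (by omega) (by omega)

lemma IsDifferential.apply_alternatingSum {n : ℕ}
    {d : Module.End K (ExteriorAlgebra K (ℕ →₀ K))}
    (hd : IsDifferential K n d) {k m : ℕ} (hm : m + 2 ≤ k) (h : 2 * k ≤ n + 1) :
    d (alternatingSum K k m) = (-1 : K) ^ m • (e K 1 * (e K (m + 2) * e K (2 * k - 2 - m))) := by
  induction m with
  | zero =>
    obtain ⟨k, rfl⟩ := Nat.exists_eq_add_of_le' hm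
    simp only [alternatingSum, zero_add, Finset.sum_range_one, pow_zero, one_smul, Nat.sub_zero]
    exact hd.apply_e_two_mul_e (b := 2 * (k + (0 + 2)) - 2) (by omega) (by omega)
  | succ m ih =>
    rw [alternatingSum, Finset.sum_range_succ, map_add, ← alternatingSum, ih (by omega), map_smul,
      show 2 * k - 1 - (m + 1) = (2 * k - 2 - (m + 1)) + 1 by omega,
      hd.apply_e_mul_e (a := m + 2) (by omega) (by omega) (by omega) (by omega),
      show 2 * k - 2 - (m + 1) + 1 = 2 * k - 2 - m by omega, pow_succ, smul_add]
    simp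

/-- The coefficients of a 2-cochain at `e^1 ∧ e^i` and at `e^k ∧ e^{k+1}`. They determine a
2-cocycle, and can be prescribed arbitrarily. -/
noncomputable def coordMap (n : ℕ) : ExteriorAlgebra K (ℕ →₀ K) →ₗ[K]
    (Finset.Icc 2 n → K) × (Finset.Icc 2 ((n + 1) / 2) → K) :=
  (LinearMap.pi fun i : Finset.Icc 2 n => coord K 1 i).prod
    (LinearMap.pi fun k : Finset.Icc 2 ((n + 1) / 2) => coord K k (k + 1))

lemma coord_alternatingSum {k i j : ℕ} (hi : 1 ≤ i) (hij : i < j) (hk : 2 ≤ k) :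
    coord K i j (alternatingSum K k (k - 2)) =
      if 2 ≤ i ∧ i + j = 2 * k + 1 then (-1) ^ i else 0 := by
  simp only [alternatingSum, map_sum, map_smul]
  have h : ∀ t ∈ Finset.range (k - 2 + 1),
      (-1 : K) ^ t • coord K i j (e K (t + 2) * e K (2 * k - 1 - t)) =
        if t + 2 = i then (if i + j = 2 * k + 1 then (-1) ^ i else 0) else 0 := by
    intro t ht
    rw [Finset.mem_range] at ht
    rw [coord_e_mul_e K hi (by omega) (by omega) (by omega), if_neg (by omega : ¬ (_ ∧ j = t + 2))]
    by_cases h : t + 2 = i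
    · subst h
      by_cases h' : j = 2 * k - 1 - t
      · rw [if_pos ⟨rfl, h'⟩, if_pos rfl, if_pos (by omega)]
        simp [pow_add]
      · rw [if_neg (by omega), if_pos rfl, if_neg (by omega)]
        simp
    · rw [if_neg (by omega), if_neg h]
      simp
  rw [Finset.sum_congr rfl h]
  by_cases h2 : 2 ≤ i ∧ i + j = 2 * k + 1
  · rw [Finset.sum_eq_single (i - 2), if_pos (by omega), if_pos h2.2, if_pos h2]
    · intro b _ hb
      exact if_neg (by omega)
    · intro h
      simp at h; omega
  · rw [if_neg h2]
    refine Finset.sum_eq_zero fun t _ => ?_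
    split_ifs <;> first | rfl | omega

namespace IsDifferential

variable {K} {n : ℕ} {d : Module.End K (ExteriorAlgebra K (ℕ →₀ K))}

lemma eq_zero_of_coordMap (hd : IsDifferential K n d) {x} (hx : x ∈ C K n 2) (hdx : d x = 0)
    (h : coordMap K n x = 0) : x = 0 := by
  have h1 : ∀ j, 2 ≤ j → j ≤ n → coord K 1 j x = 0 := fun j hj hj' =>
    congrFun (congrArg Prod.fst h) ⟨j, Finset.mem_Icc.2 ⟨hj, hj'⟩⟩
  have h2 : ∀ k, 2 ≤ k → 2 * k ≤ n + 1 → coord K k (k + 1) x = 0 := fun k hk hk' =>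
    congrFun (congrArg Prod.snd h) ⟨k, Finset.mem_Icc.2 ⟨hk, by omega⟩⟩
  have h3 := eq_zero_of_recurrence K (n := n) (c := fun i j => coord K i j x)
    (fun i j hi hj => coord_swap K hx (by omega) (by omega))
    (fun i hi => coord_self K hx (by omega))
    (fun i j hi hj => coord_eq_zero K hx (by omega) hj)
    (fun i j hi hj => by rw [← hd.coord_contr_apply hx hi hj, hdx, map_zero, map_zero]) h2
  rw [eq_sum_coord K hx]
  refine Finset.sum_eq_zero fun i hi => Finset.sum_eq_zero fun j hj => ?_
  rw [Finset.mem_Icc] at hi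
  rw [Finset.mem_Ioc] at hj
  obtain rfl | hi := hi.1.eq_or_lt
  · rw [h1 j (by omega) hj.2, zero_smul]
  · rw [h3 i j hi (by omega), zero_smul]

lemma exists_coordMap_eq (hd : IsDifferential K n d)
    (f : (Finset.Icc 2 n → K) × (Finset.Icc 2 ((n + 1) / 2) → K)) :
    ∃ x ∈ C K n 2 ⊓ LinearMap.ker d, coordMap K n x = f := by
  have hI : ∀ i : Finset.Icc 2 n, 2 ≤ (i : ℕ) ∧ (i : ℕ) ≤ n := fun i => Finset.mem_Icc.1 i.2
  have hJ : ∀ k : Finset.Icc 2 ((n + 1) / 2), 2 ≤ (k : ℕ) ∧ 2 * (k : ℕ) ≤ n + 1 := fun k => by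
    have := Finset.mem_Icc.1 k.2
    omega
  refine ⟨(∑ i, f.1 i • (e K 1 * e K i)) +
    ∑ k, (f.2 k * (-1) ^ (k : ℕ)) • alternatingSum K k (k - 2), ?_, ?_⟩
  · refine Submodule.add_mem _ (Submodule.sum_mem _ fun i _ => Submodule.smul_mem _ _ ?_)
      (Submodule.sum_mem _ fun k _ => Submodule.smul_mem _ _ ?_)
    · obtain ⟨h, h'⟩ := hI i
      exact ⟨e_mul_e_mem_C_two K le_rfl (by omega) h', hd.apply_e_one_mul_e h h'⟩
    · obtain ⟨h, h'⟩ := hJ k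
      refine ⟨alternatingSum_mem K (by omega) h', ?_⟩
      rw [SetLike.mem_coe, LinearMap.mem_ker, hd.apply_alternatingSum K (by omega) h',
        show 2 * (k : ℕ) - 2 - (k - 2) = k - 2 + 2 by omega, e_mul_self, mul_zero, smul_zero]
  · ext t
    · have ht := hI t
      change coord K 1 t _ = _
      simp only [map_add, map_sum, map_smul]
      rw [Finset.sum_eq_single t, Finset.sum_eq_zero]
      · rw [coord_e_mul_e K le_rfl (by omega) le_rfl (by omega), if_pos (by simp),
          if_neg (by omega)]
        simp
      · intro k _
        have := hJ k
        rw [coord_alternatingSum K le_rfl (by omega) (by omega), if_neg (by omega), smul_zero]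
      · intro i _ hi
        have := hI i
        have hi := Subtype.coe_ne_coe.2 hi
        rw [coord_e_mul_e K le_rfl (by omega) le_rfl (by omega), if_neg (by omega),
          if_neg (by omega)]
        simp
      · simp
    · have ht := hJ t
      change coord K t (t + 1) _ = _
      simp only [map_add, map_sum, map_smul]
      rw [Finset.sum_eq_zero, Finset.sum_eq_single t]
      · rw [coord_alternatingSum K (by omega) (by omega) (by omega), if_pos (by omega),
          smul_eq_mul, mul_assoc, ← mul_pow]
        simp
      · intro k _ hk
        have := hJ k
        have hk := Subtype.coe_ne_coe.2 hk
        rw [coord_alternatingSum K (by omega) (by omega) (by omega), if_neg (by omega), smul_zero]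
      · simp
      · intro i _
        have := hI i
        rw [coord_e_mul_e K (by omega) (by omega) le_rfl (by omega), if_neg (by omega),
          if_neg (by omega)]
        simp

lemma finrank_cocycles (hd : IsDifferential K n d) :
    Module.finrank K ↥(C K n 2 ⊓ LinearMap.ker d) = (n - 1) + ((n + 1) / 2 - 1) := by
  let F := (coordMap K n).domRestrict (C K n 2 ⊓ LinearMap.ker d)
  have hF : Function.Bijective F := by
    constructor
    · rw [← LinearMap.ker_eq_bot, LinearMap.ker_eq_bot']
      rintro ⟨x, hx, hdx⟩ h
      exact Subtype.ext (hd.eq_zero_of_coordMap hx hdx h)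
    · intro f
      obtain ⟨x, hx, h⟩ := hd.exists_coordMap_eq f
      exact ⟨⟨x, hx⟩, h⟩
  rw [(LinearEquiv.ofBijective F hF).finrank_eq]
  simp [Module.finrank_prod]

lemma map_C_one (hd : IsDifferential K n d) : (C K n 1).map d =
    Submodule.span K (Set.range fun i : Fin (n - 2) => e K 1 * e K (i + 2)) := by
  rw [C_one, Submodule.map_span]
  apply le_antisymm <;> rw [Submodule.span_le]
  · rintro _ ⟨_, ⟨a, ha, h, rfl⟩, rfl⟩
    obtain rfl | rfl | ha : a = 1 ∨ a = 2 ∨ 3 ≤ a := by omega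
    · rw [hd.one]; exact zero_mem _
    · rw [hd.two]; exact zero_mem _
    · obtain ⟨b, rfl⟩ := Nat.exists_eq_add_of_le' ha
      rw [hd.succ (b + 2) (by omega) (by omega)]
      exact Submodule.subset_span ⟨⟨b, by omega⟩, rfl⟩
  · rintro _ ⟨i, rfl⟩
    refine Submodule.subset_span ⟨e K (i + 2 + 1), ⟨_, by omega, by omega, rfl⟩, ?_⟩
    exact hd.succ _ (by omega) (by omega)

lemma finrank_coboundaries (hd : IsDifferential K n d) :
    Module.finrank K ↥((C K n 1).map d) = n - 2 := by
  rw [hd.map_C_one, finrank_span_eq_card, Fintype.card_fin]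
  rw [Fintype.linearIndependent_iff]
  intro g hg i
  have h := congrArg (coord K 1 (i + 2)) hg
  rw [map_sum, map_zero, Finset.sum_eq_single i] at h
  · rw [map_smul, coord_e_mul_e K le_rfl (by omega) le_rfl (by omega), if_pos (by simp),
      if_neg (by omega)] at h
    simpa using h
  · intro j _ hj
    have hj := Fin.val_ne_of_ne hj
    rw [map_smul, coord_e_mul_e K le_rfl (by omega) le_rfl (by omega), if_neg (by omega),
      if_neg (by omega)]
    simp
  · simp

end IsDifferential

/-- For the `n`-dimensional filiform Lie algebra `m₀(n)` (`n ≥ 2`) with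
Chevalley–Eilenberg differential `d` (`d e^1 = d e^2 = 0`,
`d e^{i+1} = e^1 ∧ e^i` for `2 ≤ i ≤ n-1`):
`dim H^2(m₀(n)) = ⌊(n+1)/2⌋`. -/
theorem stmt19 (n : ℕ) (hn : 2 ≤ n)
    (d : Module.End K (ExteriorAlgebra K (ℕ →₀ K)))
    (hLeib : ∀ p : ℕ, ∀ x ∈ C K n p, ∀ y,
      d (x * y) = d x * y + ((-1 : K) ^ p) • (x * d y))
    (h1 : d (e K 1) = 0) (h2 : d (e K 2) = 0)
    (hd : ∀ i, 2 ≤ i → i ≤ n - 1 → d (e K (i + 1)) = e K 1 * e K i) :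
    Module.finrank K ↥(C K n 2 ⊓ LinearMap.ker d) -
      Module.finrank K ↥((C K n 1).map d) = (n + 1) / 2 := by
  have h : IsDifferential K n d := ⟨hLeib, h1, h2, hd⟩
  rw [h.finrank_cocycles, h.finrank_coboundaries]
  omega
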